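/- arXiv:2101.01376 — 4 statements merged into one kernel-verified Lean document; each statement's English description precedes it below -/
import Mathlib

section
/- Let σ > 0 and for a ∈ ℝ let ν_a denote the Gaussian probability measure on ℝ with mean a and variance σ² (the law of a + Z where Z is a centered Gaussian with variance σ²). Then for all a, a' ∈ ℝ with a ≠ a', all ε > 0, and every Borel set R ⊆ ℝ, one has ν_a(R) ≤ e^ε · ν_{a'}(R) + Q(εσ/|a − a'| − |a − a'|/(2σ)), where Q(w) := (2π)^{-1/2} ∫_w^∞ e^{-v²/2} dv is the standard Gaussian tail function. -/
open MeasureTheory ProbabilityTheory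

/-- The standard Gaussian tail function `Q(w) = (2π)^{-1/2} ∫_w^∞ e^{-v²/2} dv`. -/
noncomputable def gaussTail (w : ℝ) : ℝ :=
    (2 * Real.pi) ^ (-(1 : ℝ) / 2) * ∫ v in Set.Ioi w, Real.exp (-v ^ 2 / 2)

/-- The measure of a set under a nondegenerate real Gaussian, as a real set integral. -/
lemma gaussianReal_toReal_eq_setIntegral (μ : ℝ) {v : NNReal} (hv : v ≠ 0) (s : Set ℝ) :
    (gaussianReal μ v s).toReal = ∫ x in s, gaussianPDFReal μ v x := by
  rw [gaussianReal_apply_eq_integral μ hv,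
    ENNReal.toReal_ofReal (integral_nonneg fun x => gaussianPDFReal_nonneg μ v x)]

/-- `gaussTail` is the upper tail of the standard Gaussian measure. -/
lemma gaussianReal_Ioi_toReal_eq_gaussTail (w : ℝ) :
    (gaussianReal 0 1 (Set.Ioi w)).toReal = gaussTail w := by
  rw [gaussianReal_toReal_eq_setIntegral 0 one_ne_zero, gaussTail, ← integral_const_mul]
  congr 1 with v
  simp only [gaussianPDFReal, NNReal.coe_one, mul_one, sub_zero]
  rw [Real.sqrt_eq_rpow, ← Real.rpow_neg (by positivity)]
  norm_num

/-- Standardizing a real Gaussian by a signed standard deviation. -/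
lemma gaussianReal_map_standardize (a s : ℝ) {v : NNReal} (hv : v ≠ 0) (hs : s ^ 2 = v) :
    (gaussianReal a v).map (fun x => (x - a) / s) = gaussianReal 0 1 := by
  have h : (fun x : ℝ => (x - a) / s) = (fun x => x / s) ∘ (fun x => x - a) := rfl
  rw [h, ← Measure.map_map (by fun_prop) (by fun_prop), gaussianReal_map_sub_const,
    gaussianReal_map_div_const]
  have hs' : NNReal.mk (s ^ 2) (sq_nonneg s) = v := NNReal.eq hs
  congr 1
  · simp
  · rw [hs', div_self hv]

/-- If the density of one Gaussian is at most `e^ε` times that of another off a measurable set `B`,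
then the corresponding measures satisfy the same bound up to the mass of `B`. -/
lemma gaussianReal_toReal_le_of_pdf_le {a a' ε : ℝ} {v : NNReal} (hv : v ≠ 0) {R B : Set ℝ}
    (hR : MeasurableSet R) (hB : MeasurableSet B)
    (h : ∀ x ∉ B, gaussianPDFReal a v x ≤ Real.exp ε * gaussianPDFReal a' v x) :
    (gaussianReal a v R).toReal ≤
      Real.exp ε * (gaussianReal a' v R).toReal + (gaussianReal a v B).toReal := by
  have hdiff : (gaussianReal a v).real (R \ B) ≤ Real.exp ε * (gaussianReal a' v).real (R \ B) := by
    simp only [Measure.real, gaussianReal_toReal_eq_setIntegral _ hv]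
    rw [← integral_const_mul]
    exact setIntegral_mono_on (integrable_gaussianPDFReal a v).integrableOn
      ((integrable_gaussianPDFReal a' v).const_mul _).integrableOn (hR.diff hB)
      fun x hx => h x hx.2
  have hmono : (gaussianReal a' v).real (R \ B) ≤ (gaussianReal a' v).real R :=
    measureReal_mono Set.sdiff_subset
  calc (gaussianReal a v).real R ≤ (gaussianReal a v).real (R \ B ∪ B) :=
        measureReal_mono (by simp)
    _ ≤ (gaussianReal a v).real (R \ B) + (gaussianReal a v).real B := measureReal_union_le _ _
    _ ≤ Real.exp ε * (gaussianReal a' v).real R + (gaussianReal a v).real B := by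
        gcongr
        exact hdiff.trans (by gcongr)

/-- One-dimensional Gaussian-mechanism inequality: for Gaussian measures `ν_a`,
`ν_{a'}` on `ℝ` with common variance `σ²` and distinct means `a ≠ a'`,
`ν_a(R) ≤ e^ε ν_{a'}(R) + Q(εσ/|a − a'| − |a − a'|/(2σ))` for every Borel set
`R` and every `ε > 0`. -/
theorem stmt2 (σ : ℝ) (hσ : 0 < σ) (a a' : ℝ) (haa : a ≠ a')
    (ε : ℝ) (hε : 0 < ε) (R : Set ℝ) (hR : MeasurableSet R) :
    (gaussianReal a (σ.toNNReal ^ 2) R).toReal ≤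
      Real.exp ε * (gaussianReal a' (σ.toNNReal ^ 2) R).toReal +
        gaussTail (ε * σ / |a - a'| - |a - a'| / (2 * σ)) := by
  have hd : 0 < |a - a'| := abs_pos.mpr (sub_ne_zero.mpr haa)
  have hv : σ.toNNReal ^ 2 ≠ 0 := pow_ne_zero _ (Real.toNNReal_pos.mpr hσ).ne'
  have hvσ : ((σ.toNNReal ^ 2 : NNReal) : ℝ) = σ ^ 2 := by simp [hσ.le]
  set w := ε * σ / |a - a'| - |a - a'| / (2 * σ) with hw
  set s := σ * (a - a') / |a - a'| with hs
  have hs2 : s ^ 2 = σ ^ 2 := by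
    rw [hs, div_pow, mul_pow, sq_abs]
    exact mul_div_cancel_right₀ _ (pow_ne_zero _ (sub_ne_zero.mpr haa))
  have hs0 : s ≠ 0 := pow_ne_zero_iff two_ne_zero |>.mp (hs2 ▸ pow_ne_zero 2 hσ.ne')
  have hsd : s * (a - a') = σ * |a - a'| := by
    rw [hs]
    field_simp
    exact (sq_abs _).symm
  have hmeas : Measurable fun x : ℝ => (x - a) / s := by fun_prop
  rw [← gaussianReal_Ioi_toReal_eq_gaussTail, ← gaussianReal_map_standardize a s hv
    (hs2.trans hvσ.symm), Measure.map_apply hmeas measurableSet_Ioi]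
  refine gaussianReal_toReal_le_of_pdf_le hv hR (hmeas measurableSet_Ioi) fun x hx => ?_
  obtain ⟨u, rfl⟩ : ∃ u, x = a + s * u := ⟨(x - a) / s, by field_simp; ring⟩
  have hu : u ≤ w := by simpa [hs0] using hx
  have hlog : u * |a - a'| / σ + |a - a'| ^ 2 / (2 * σ ^ 2) ≤ ε := by
    calc _ ≤ w * |a - a'| / σ + |a - a'| ^ 2 / (2 * σ ^ 2) := by gcongr
      _ = ε := by rw [hw]; field_simp; ring
  have hexp : -(a + s * u - a) ^ 2 / (2 * σ ^ 2) = (u * |a - a'| / σ + |a - a'| ^ 2 / (2 * σ ^ 2))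
      + -(a + s * u - a') ^ 2 / (2 * σ ^ 2) := by
    rw [sq_abs]
    field_simp
    linear_combination 2 * u * hsd
  simp only [gaussianPDFReal, hvσ]
  rw [mul_left_comm, ← Real.exp_add, hexp]
  gcongr
end

section
/- Let n, N ≥ 1, let C ∈ ℝ^{n×n} and D ∈ ℝ^{n×N} with D ≠ 0, and let λ > 0 be the smallest nonzero singular value of D. Let σ > 0 and, for β ∈ ℝⁿ, let μ_β denote the law on ℝⁿ of the random vector Cβ + Dγ, where γ = (γ₁, …, γ_N) has independent entries each distributed as a centered Gaussian with variance σ² (i.e., μ_β is the pushforward of the N-fold product of N(0, σ²) under γ ↦ Cβ + Dγ). Let ε > 0, δ ∈ (0, 1/2), s > 0, and let w ∈ ℝ satisfy Q(w) = δ. If σ ≥ s(w + √(w² + 2ε))/(2ελ), then for all β, β' ∈ ℝⁿ such that C(β − β') lies in the column space of D and ‖C(β − β')‖₂ ≤ s, and for every Borel set R ⊆ ℝⁿ, one has μ_β(R) ≤ e^ε · μ_{β'}(R) + δ. -/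
open MeasureTheory ProbabilityTheory Matrix

/-- A translated centered Gaussian has an exponential density with respect to the original one. -/
lemma gaussianReal_eq_withDensity_gaussianReal_zero (m : ℝ) {v : NNReal} (hv : v ≠ 0) :
    gaussianReal m v = (gaussianReal 0 v).withDensity
      (fun x => ENNReal.ofReal (Real.exp ((m * x - m ^ 2 / 2) / v))) := by
  rw [gaussianReal_of_var_ne_zero _ hv, gaussianReal_of_var_ne_zero _ hv,
    ← withDensity_mul _ (measurable_gaussianPDF 0 v) (by fun_prop)]
  congr 1
  ext x
  have hv' : (v : ℝ) ≠ 0 := by exact_mod_cast hv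
  rw [Pi.mul_apply, gaussianPDF, gaussianPDF, gaussianPDFReal, gaussianPDFReal,
    ← ENNReal.ofReal_mul (by positivity), mul_assoc (√_)⁻¹, ← Real.exp_add]
  congr 3
  field_simp
  ring

/-- A product of measures with densities is the product measure with the product density. -/
lemma pi_withDensity {ι : Type*} [Fintype ι] {α : ι → Type*} [∀ i, MeasurableSpace (α i)]
    (μ : ∀ i, Measure (α i)) [∀ i, IsProbabilityMeasure (μ i)]
    (f : ∀ i, α i → ENNReal) (hf : ∀ i, Measurable (f i))
    [∀ i, SigmaFinite ((μ i).withDensity (f i))] :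
    Measure.pi (fun i => (μ i).withDensity (f i)) =
      (Measure.pi μ).withDensity (fun x => ∏ i, f i (x i)) := by
  refine Measure.pi_eq fun s hs => ?_
  have hg (i : ι) : Measurable ((s i).indicator (f i)) := (hf i).indicator (hs i)
  rw [withDensity_apply _ (MeasurableSet.univ_pi hs),
    ← lintegral_indicator (MeasurableSet.univ_pi hs)]
  have hprod (x : ∀ i, α i) :
      (Set.univ.pi s).indicator (fun x => ∏ i, f i (x i)) x =
        ∏ i, (s i).indicator (f i) (x i) := by
    by_cases hx : x ∈ Set.univ.pi s
    · rw [Set.indicator_of_mem hx]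
      exact Finset.prod_congr rfl fun i _ =>
        (Set.indicator_of_mem (hx i (Set.mem_univ i)) _).symm
    · rw [Set.indicator_of_notMem hx]
      obtain ⟨i, hi⟩ : ∃ i, x i ∉ s i := by simpa using hx
      exact (Finset.prod_eq_zero (Finset.mem_univ i) (Set.indicator_of_notMem hi _)).symm
  simp_rw [hprod]
  rw [lintegral_prod_eq_prod_lintegral_of_indepFun Finset.univ
    (fun i (x : ∀ i, α i) => (s i).indicator (f i) (x i))
    (iIndepFun_pi fun i => (hg i).aemeasurable) (fun i => (hg i).comp (measurable_pi_apply i))]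
  refine Finset.prod_congr rfl fun i _ => ?_
  rw [(measurePreserving_eval μ i).lintegral_comp (hg i), lintegral_indicator (hs i),
    withDensity_apply _ (hs i)]

/-- Cameron–Martin formula for the product of finitely many centered Gaussians. -/
lemma map_const_add_pi_gaussianReal {ι : Type*} [Fintype ι] (u : ι → ℝ) {v : NNReal}
    (hv : v ≠ 0) :
    (Measure.pi fun _ : ι => gaussianReal 0 v).map (fun x => u + x) =
      (Measure.pi fun _ : ι => gaussianReal 0 v).withDensity
        (fun x => ENNReal.ofReal (Real.exp ((u ⬝ᵥ x - u ⬝ᵥ u / 2) / v))) := by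
  have hmap : (Measure.pi fun _ : ι => gaussianReal 0 v).map (fun x => u + x) =
      Measure.pi fun i => gaussianReal (u i) v := by
    have h := Measure.pi_map_pi (μ := fun _ : ι => gaussianReal 0 v)
      (f := fun i x => u i + x) (fun i => by fun_prop)
    simp_rw [gaussianReal_map_const_add, zero_add] at h
    exact h
  have hd (i : ι) := gaussianReal_eq_withDensity_gaussianReal_zero (u i) hv
  have (i : ι) : SigmaFinite ((gaussianReal 0 v).withDensity
      (fun x => ENNReal.ofReal (Real.exp ((u i * x - u i ^ 2 / 2) / v)))) := by
    rw [← hd i]; infer_instance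
  rw [hmap, funext hd, pi_withDensity _ _ (fun i => by fun_prop)]
  congr 1
  ext x
  rw [← ENNReal.ofReal_prod_of_nonneg fun i _ => (Real.exp_pos _).le, ← Real.exp_sum,
    ← Finset.sum_div, Finset.sum_sub_distrib, ← Finset.sum_div]
  simp only [dotProduct, pow_two]

/-- A linear functional of a vector of i.i.d. centered Gaussians is a centered Gaussian. -/
lemma map_dotProduct_pi_gaussianReal {ι : Type*} [Fintype ι] (u : ι → ℝ) (v : NNReal) :
    (Measure.pi fun _ : ι => gaussianReal 0 v).map (fun x => u ⬝ᵥ x) =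
      gaussianReal 0 (v * (u ⬝ᵥ u).toNNReal) := by
  let L : (ι → ℝ) →L[ℝ] ℝ := ∑ i, u i • ContinuousLinearMap.proj i
  have hL : (L : (ι → ℝ) → ℝ) = fun x => u ⬝ᵥ x := by
    ext x; simp [L, dotProduct]
  have hsum : (fun x : ι → ℝ => u ⬝ᵥ x) = ∑ i, fun x : ι → ℝ => u i * x i := by
    ext x; simp [dotProduct]
  have hG : IsGaussian (Measure.pi fun _ : ι => gaussianReal 0 v) := by
    have hlaw : HasGaussianLaw (id : (ι → ℝ) → ι → ℝ) (Measure.pi fun _ => gaussianReal 0 v) :=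
      iIndepFun.hasGaussianLaw (X := fun i (x : ι → ℝ) => x i)
        (fun i => ⟨by
          rw [(measurePreserving_eval (fun _ : ι => gaussianReal 0 v) i).map_eq]
          infer_instance⟩)
        (iIndepFun_pi (X := fun _ x => x) fun _ => aemeasurable_id)
    simpa using hlaw.isGaussian_map
  have h := hG.map_eq_gaussianReal L
  rw [hL] at h
  rw [h]
  congr 1
  · simp_rw [dotProduct]
    rw [integral_finsetSum]
    · refine Finset.sum_eq_zero fun i _ => ?_
      rw [integral_const_mul, integral_eval, integral_id_gaussianReal, mul_zero]
    · exact fun i _ => (integrable_eval IsGaussian.integrable_id).const_mul _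
  · rw [hsum, variance_sum_pi (X := fun i x => u i * x)
      (fun i => IsGaussian.memLp_two_id.const_mul _)]
    have hvar (i : ι) : Var[fun x => u i * x; gaussianReal 0 v] = u i ^ 2 * v := by
      rw [variance_const_mul, variance_fun_id_gaussianReal]
    rw [Finset.sum_congr rfl fun i _ => hvar i, ← Finset.sum_mul, mul_comm,
      Real.toNNReal_mul v.coe_nonneg, Real.toNNReal_coe]
    simp [dotProduct, pow_two]

/-- `gaussTail` is the upper tail of the standard Gaussian distribution. -/
lemma gaussianReal_Ioi_eq_gaussTail (w : ℝ) :
    gaussianReal 0 1 (Set.Ioi w) = ENNReal.ofReal (gaussTail w) := by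
  rw [gaussianReal_apply_eq_integral _ one_ne_zero, gaussTail, ← integral_const_mul]
  congr 1
  refine integral_congr_ae (Filter.Eventually.of_forall fun x => ?_)
  simp only [gaussianPDFReal, NNReal.coe_one, mul_one, sub_zero]
  rw [neg_div (2 : ℝ) 1, Real.rpow_neg (by positivity), Real.sqrt_eq_rpow]

/-- A tail bound for linear functionals of i.i.d. centered Gaussians of variance `σ²`. -/
lemma pi_gaussianReal_dotProduct_gt_le {ι : Type*} [Fintype ι] (u : ι → ℝ) {σ w a : ℝ}
    (hσ : 0 ≤ σ) (ha : w * (σ * √(u ⬝ᵥ u)) ≤ a) :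
    (Measure.pi fun _ : ι => gaussianReal 0 (σ.toNNReal ^ 2)) {x | a < u ⬝ᵥ x} ≤
      ENNReal.ofReal (gaussTail w) := by
  have hu : 0 ≤ u ⬝ᵥ u := by simpa using dotProduct_star_self_nonneg u
  have hmeas : Measurable fun x : ι → ℝ => u ⬝ᵥ x := by unfold dotProduct; fun_prop
  have hscale : gaussianReal 0 (σ.toNNReal ^ 2 * (u ⬝ᵥ u).toNNReal) =
      (gaussianReal 0 1).map (σ * √(u ⬝ᵥ u) * ·) := by
    rw [gaussianReal_map_const_mul, mul_zero, mul_one]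
    congr 1
    ext
    simp [mul_pow, Real.sq_sqrt hu, hσ, hu]
  calc (Measure.pi fun _ : ι => gaussianReal 0 (σ.toNNReal ^ 2)) {x | a < u ⬝ᵥ x}
      = (gaussianReal 0 1).map (σ * √(u ⬝ᵥ u) * ·) (Set.Ioi a) := by
        rw [← hscale, ← map_dotProduct_pi_gaussianReal, Measure.map_apply hmeas measurableSet_Ioi]
        rfl
    _ ≤ gaussianReal 0 1 (Set.Ioi w) := by
        rw [Measure.map_apply (by fun_prop) measurableSet_Ioi]
        refine measure_mono fun x hx => ?_
        have hx : a < σ * √(u ⬝ᵥ u) * x := hx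
        refine lt_of_mul_lt_mul_left ?_ (by positivity : 0 ≤ σ * √(u ⬝ᵥ u))
        linarith
    _ = _ := gaussianReal_Ioi_eq_gaussTail w

/-- If `ν` has density `f` with respect to `μ`, the privacy loss is controlled by the mass that
`ν` gives to the set where `f` is large. -/
lemma withDensity_apply_le_mul_add {α : Type*} [MeasurableSpace α] (μ : Measure α)
    {f : α → ENNReal} (hf : Measurable f) (c : ENNReal) {A : Set α} (hA : MeasurableSet A) :
    μ.withDensity f A ≤ c * μ A + μ.withDensity f {x | c < f x} := by
  have hB : MeasurableSet {x | c < f x} := measurableSet_lt measurable_const hf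
  calc μ.withDensity f A
      ≤ μ.withDensity f (A \ {x | c < f x} ∪ {x | c < f x}) :=
        measure_mono fun x hx => by by_cases h : c < f x <;> simp [hx, h]
    _ ≤ μ.withDensity f (A \ {x | c < f x}) + μ.withDensity f {x | c < f x} :=
        measure_union_le _ _
    _ ≤ c * μ A + μ.withDensity f {x | c < f x} := by
        gcongr
        rw [withDensity_apply _ (hA.diff hB)]
        calc ∫⁻ x in A \ {x | c < f x}, f x ∂μ
            ≤ ∫⁻ _ in A \ {x | c < f x}, c ∂μ :=
              setLIntegral_mono measurable_const fun x hx => not_lt.1 hx.2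
          _ ≤ c * μ A := by
              rw [setLIntegral_const]
              gcongr
              exact Set.sdiff_subset

/-- The Gaussian mechanism with shift `u`, for noise satisfying the tail condition. -/
lemma pi_gaussianReal_map_const_add_le {ι : Type*} [Fintype ι] (u : ι → ℝ) {σ ε w : ℝ}
    (hσ : 0 < σ) (hu : w * (σ * √(u ⬝ᵥ u)) ≤ σ ^ 2 * ε - u ⬝ᵥ u / 2)
    {A : Set (ι → ℝ)} (hA : MeasurableSet A) :
    (Measure.pi fun _ : ι => gaussianReal 0 (σ.toNNReal ^ 2)).map (fun x => u + x) A ≤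
      ENNReal.ofReal (Real.exp ε) *
        (Measure.pi fun _ : ι => gaussianReal 0 (σ.toNNReal ^ 2)) A +
        ENNReal.ofReal (gaussTail w) := by
  have hv : σ.toNNReal ^ 2 ≠ 0 := by simpa using hσ
  have hdot : Measurable fun x : ι → ℝ => u ⬝ᵥ x := by unfold dotProduct; fun_prop
  have hf : Measurable fun x : ι → ℝ => ENNReal.ofReal
      (Real.exp ((u ⬝ᵥ x - u ⬝ᵥ u / 2) / ((σ.toNNReal ^ 2 : NNReal) : ℝ))) := by fun_prop
  have h := withDensity_apply_le_mul_add
    (Measure.pi fun _ : ι => gaussianReal 0 (σ.toNNReal ^ 2)) hf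
    (ENNReal.ofReal (Real.exp ε)) hA
  have hB := measurableSet_lt (measurable_const (a := ENNReal.ofReal (Real.exp ε))) hf
  rw [← map_const_add_pi_gaussianReal u hv, Measure.map_apply (by fun_prop) hB] at h
  refine h.trans (add_le_add_right ?_ _)
  refine le_trans (measure_mono fun x hx => ?_) (pi_gaussianReal_dotProduct_gt_le u hσ.le hu)
  have hx : ENNReal.ofReal (Real.exp ε) < ENNReal.ofReal
      (Real.exp ((u ⬝ᵥ (u + x) - u ⬝ᵥ u / 2) / ((σ.toNNReal ^ 2 : NNReal) : ℝ))) := hx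
  rw [ENNReal.ofReal_lt_ofReal_iff (Real.exp_pos _), Real.exp_lt_exp, NNReal.coe_pow,
    Real.coe_toNNReal _ hσ.le, lt_div_iff₀ (by positivity), dotProduct_add] at hx
  have : σ ^ 2 * ε - u ⬝ᵥ u / 2 < u ⬝ᵥ x := by linarith
  exact this

/-- Noise calibrated to sensitivity `r` satisfies the tail condition for every shift of size
`t ≤ r`. -/
lemma gaussian_tail_condition {σ ε w r t : ℝ} (hε : 0 < ε) (ht : 0 ≤ t) (htr : t ≤ r)
    (hσ : r * (w + √(w ^ 2 + 2 * ε)) ≤ 2 * ε * σ) :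
    w * (σ * t) ≤ σ ^ 2 * ε - t ^ 2 / 2 := by
  have hS := Real.sq_sqrt (by positivity : 0 ≤ w ^ 2 + 2 * ε)
  have hS0 := Real.sqrt_nonneg (w ^ 2 + 2 * ε)
  have hwS : 0 ≤ w + √(w ^ 2 + 2 * ε) := by
    have := Real.abs_le_sqrt (by linarith : w ^ 2 ≤ w ^ 2 + 2 * ε)
    linarith [neg_abs_le w]
  set S := √(w ^ 2 + 2 * ε)
  have h : t * S ≤ 2 * ε * σ - t * w := by
    linarith [mul_le_mul_of_nonneg_right htr hwS]
  have hsq : (t * S) ^ 2 ≤ (2 * ε * σ - t * w) ^ 2 :=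
    pow_le_pow_left₀ (by positivity) h 2
  rw [mul_pow, hS] at hsq
  have : 0 ≤ 4 * ε * (σ ^ 2 * ε - t ^ 2 / 2 - w * (σ * t)) := by linarith
  linarith [nonneg_of_mul_nonneg_right this (by positivity)]

/-- Every vector in the range of `D` has a preimage whose length is controlled by the smallest
nonzero singular value of `D`. -/
lemma exists_mulVec_eq_of_mem_range {m n : Type*} [Fintype m] [Fintype n]
    (D : Matrix m n ℝ) {lam : ℝ} (hlam : 0 < lam)
    (hmin : ∀ (c : ℝ) (x : m → ℝ), x ≠ 0 → (D * Dᵀ) *ᵥ x = c • x → c ≠ 0 → lam ^ 2 ≤ c)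
    {x : m → ℝ} (hx : x ∈ Set.range D.mulVec) :
    ∃ u, D *ᵥ u = x ∧ lam ^ 2 * (u ⬝ᵥ u) ≤ x ⬝ᵥ x := by
  classical
  have hA : (D * Dᵀ).IsHermitian := by
    simpa [conjTranspose_eq_transpose_of_trivial] using isHermitian_mul_conjTranspose_self D
  let b := hA.eigenvectorBasis
  let c : m → ℝ := fun i => x ⬝ᵥ (b i).ofLp
  have hinner (i : m) : inner ℝ (b i) (WithLp.toLp 2 x) = c i := by
    simp [EuclideanSpace.inner_eq_star_dotProduct, c]
  have hsum : ∑ i, c i • (b i).ofLp = x := by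
    have h := congrArg WithLp.ofLp (b.sum_repr' (WithLp.toLp 2 x))
    simpa [hinner] using h
  have hparseval : ∑ i, c i ^ 2 = x ⬝ᵥ x := by
    have h := b.sum_sq_inner_right (WithLp.toLp 2 x)
    simp only [hinner] at h
    rw [h, EuclideanSpace.real_norm_sq_eq]
    simp [dotProduct, pow_two]
  have heig (i : m) : (D * Dᵀ) *ᵥ (b i).ofLp = hA.eigenvalues i • (b i).ofLp :=
    hA.mulVec_eigenvectorBasis i
  have hne (i : m) : (b i).ofLp ≠ 0 := by
    simpa using b.toBasis.ne_zero i
  have hc (i : m) (hi : hA.eigenvalues i = 0) : c i = 0 := by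
    obtain ⟨v, rfl⟩ := hx
    have h0 : Dᵀ *ᵥ (b i).ofLp = 0 := by
      rw [← dotProduct_self_eq_zero, dotProduct_mulVec, vecMul_transpose, mulVec_mulVec, heig, hi]
      simp
    change D *ᵥ v ⬝ᵥ (b i).ofLp = 0
    rw [dotProduct_comm, ← dotProduct_transpose_mulVec, h0, dotProduct_zero]
  let y : m → ℝ := ∑ i, ((hA.eigenvalues i)⁻¹ * c i) • (b i).ofLp
  have hy : (D * Dᵀ) *ᵥ y = x := by
    simp only [y, mulVec_sum, mulVec_smul, heig, smul_smul]
    refine Eq.trans (Finset.sum_congr rfl fun i _ => ?_) hsum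
    by_cases hi : hA.eigenvalues i = 0
    · simp [hc i hi]
    · congr 1
      field_simp
  refine ⟨Dᵀ *ᵥ y, by rw [mulVec_mulVec, hy], ?_⟩
  have hnorm : Dᵀ *ᵥ y ⬝ᵥ Dᵀ *ᵥ y = ∑ i, (hA.eigenvalues i)⁻¹ * c i ^ 2 := by
    rw [dotProduct_mulVec, vecMul_transpose, mulVec_mulVec, hy]
    simp only [y, dotProduct_sum, dotProduct_smul, smul_eq_mul]
    exact Finset.sum_congr rfl fun i _ => by rw [pow_two, mul_assoc]
  rw [hnorm, ← hparseval, Finset.mul_sum]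
  refine Finset.sum_le_sum fun i _ => ?_
  by_cases hi : hA.eigenvalues i = 0
  · simp [hc i hi]
  · have hle := hmin _ _ (hne i) (heig i) hi
    have hpos : 0 < hA.eigenvalues i := lt_of_lt_of_le (by positivity) hle
    rw [← mul_assoc, ← div_eq_mul_inv]
    exact mul_le_of_le_one_left (sq_nonneg _) ((div_le_one hpos).2 hle)

/-- The core of Theorem 1: the affine-Gaussian mechanism `β ↦ Cβ + Dγ`, where
`γ` is a vector of `N` i.i.d. centered Gaussians of variance `σ²`, is
`(ε,δ)`-differentially private for inputs `β, β'` such that `C(β − β')` lies in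
the column space of `D` with `‖C(β − β')‖₂ ≤ s`, provided
`σ ≥ s(w + √(w² + 2ε))/(2ελ)` where `Q(w) = δ` and `λ > 0` is the smallest
nonzero singular value of `D` (i.e. `λ²` is the smallest nonzero eigenvalue of
`D Dᵀ`). -/
theorem stmt3 (n N : ℕ) (hn : 1 ≤ n) (hN : 1 ≤ N)
    (C : Matrix (Fin n) (Fin n) ℝ) (D : Matrix (Fin n) (Fin N) ℝ) (hD : D ≠ 0)
    (lam : ℝ) (hlam : 0 < lam)
    (hlam_ev : ∃ x : Fin n → ℝ, x ≠ 0 ∧ (D * Dᵀ).mulVec x = lam ^ 2 • x)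
    (hlam_min : ∀ (c : ℝ) (x : Fin n → ℝ), x ≠ 0 → (D * Dᵀ).mulVec x = c • x →
      c ≠ 0 → lam ^ 2 ≤ c)
    (σ ε δ s w : ℝ) (hσ0 : 0 < σ) (hε : 0 < ε) (hδ0 : 0 < δ) (hδ : δ < 1 / 2)
    (hs : 0 < s) (hw : gaussTail w = δ)
    (hσ : σ ≥ s * (w + Real.sqrt (w ^ 2 + 2 * ε)) / (2 * ε * lam))
    (β β' : Fin n → ℝ)
    (hrange : C.mulVec (β - β') ∈ Set.range D.mulVec)
    (hnorm : Real.sqrt (∑ i, (C.mulVec (β - β') i) ^ 2) ≤ s)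
    (R : Set (Fin n → ℝ)) (hR : MeasurableSet R) :
    (Measure.map (fun γ => C.mulVec β + D.mulVec γ)
        (Measure.pi fun _ : Fin N => gaussianReal 0 (σ.toNNReal ^ 2)) R).toReal
      ≤ Real.exp ε *
        (Measure.map (fun γ => C.mulVec β' + D.mulVec γ)
          (Measure.pi fun _ : Fin N => gaussianReal 0 (σ.toNNReal ^ 2)) R).toReal
        + δ := by
  obtain ⟨u, hu, hu_le⟩ := exists_mulVec_eq_of_mem_range D hlam hlam_min hrange
  have huu : 0 ≤ u ⬝ᵥ u := by simpa using dotProduct_star_self_nonneg u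
  have hxx : C *ᵥ (β - β') ⬝ᵥ C *ᵥ (β - β') ≤ s ^ 2 := by
    rw [Real.sqrt_le_left hs.le] at hnorm
    simpa only [dotProduct, pow_two] using hnorm
  have hu_s : √(u ⬝ᵥ u) ≤ s / lam := by
    refine Real.sqrt_le_iff.2 ⟨by positivity, ?_⟩
    rw [div_pow, le_div_iff₀ (by positivity)]
    linarith
  have hcal : s / lam * (w + √(w ^ 2 + 2 * ε)) ≤ 2 * ε * σ := by
    rw [ge_iff_le, div_le_iff₀ (by positivity)] at hσ
    rw [div_mul_eq_mul_div, div_le_iff₀ hlam]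
    linarith
  have hcond := gaussian_tail_condition hε (Real.sqrt_nonneg (u ⬝ᵥ u)) hu_s hcal
  rw [Real.sq_sqrt huu] at hcond
  have hD_meas : Measurable fun γ => C *ᵥ β' + D *ᵥ γ :=
    (continuous_const.add (continuous_const.matrix_mulVec continuous_id)).measurable
  have hshift : (fun γ => C *ᵥ β + D *ᵥ γ) =
      (fun γ => C *ᵥ β' + D *ᵥ γ) ∘ (fun γ => u + γ) := by
    ext1 γ
    rw [Function.comp_apply, mulVec_add, hu, mulVec_sub]
    abel
  have hmain := pi_gaussianReal_map_const_add_le u hσ0 hcond (hD_meas hR)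
  rw [hw] at hmain
  rw [hshift, ← Measure.map_map hD_meas (by fun_prop), Measure.map_apply hD_meas hR,
    Measure.map_apply hD_meas hR]
  refine (ENNReal.toReal_mono (by finiteness) hmain).trans_eq ?_
  rw [ENNReal.toReal_add (by finiteness) (by finiteness), ENNReal.toReal_mul,
    ENNReal.toReal_ofReal (Real.exp_pos ε).le, ENNReal.toReal_ofReal hδ0.le]
end

section
/- Fix integers n, q, S ≥ 1 and a real σ > 0. Let (Ω, F, P) be a probability space carrying measurable random matrices C: Ω → ℝ^{n×n} and D: Ω → ℝ^{n×(qS)} and a square-integrable random vector γ: Ω → ℝ^{qS} that is independent of the pair (C, D), with E[γ] = 0 and E‖γ‖² ≤ qSσ². Assume that almost surely: ‖C‖_F ≤ √n, ‖D‖_F ≤ √(2qS), 𝟙ₙᵀC = 𝟙ₙᵀ, and 𝟙ₙᵀD = 0. Let A ∈ ℝ^{n×n} be a symmetric matrix with A𝟙ₙ = 0 and all eigenvalues in [0, 1], and let λ_G be its second-smallest eigenvalue (eigenvalues counted with multiplicity). Then for every x₀ ∈ ℝⁿ and every integer T ≥ 0, the random vector x := (I − A)^T (C x₀ + D γ) satisfies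 E‖x − (1/n)𝟙ₙ𝟙ₙᵀx₀‖² ≤ (n‖x₀‖² + 2q²S²σ²)·(1 − λ_G)^{2T}. -/
open MeasureTheory ProbabilityTheory Matrix


/-- Matrices over `ℝ` carry the product (entrywise) measurable structure. -/
instance matrixMeasurableSpace (m n : Type*) : MeasurableSpace (Matrix m n ℝ) :=
  inferInstanceAs (MeasurableSpace (m → n → ℝ))

/-- At most one of the roots of a real polynomial lies strictly below its second-smallest root,
however the roots are enumerated. -/
lemma le_of_ne_of_lt_second_root {n : ℕ} (hn2 : 2 ≤ n) {e μ : Fin n → ℝ} (hmono : Monotone e)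
    (h : ∏ i, (Polynomial.X - Polynomial.C (μ i)) = ∏ i, (Polynomial.X - Polynomial.C (e i)))
    {i j : Fin n} (hij : j ≠ i) (hi : μ i < e ⟨1, hn2⟩) : e ⟨1, hn2⟩ ≤ μ j := by
  by_contra! hj
  have hroots : Finset.univ.val.map μ = Finset.univ.val.map e := by
    have hroots_eq : ∀ f : Fin n → ℝ,
        (∏ i, (Polynomial.X - Polynomial.C (f i))).roots = Finset.univ.val.map f := by
      intro f
      have := Polynomial.roots_multiset_prod_X_sub_C (Finset.univ.val.map f)
      rwa [Multiset.map_map] at this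
    rw [← hroots_eq, h, hroots_eq]
  have hcard := congrArg (Multiset.countP (· < e ⟨1, hn2⟩)) hroots
  rw [Multiset.countP_map, Multiset.countP_map] at hcard
  change (Finset.univ.filter fun k => μ k < e ⟨1, hn2⟩).card =
    (Finset.univ.filter fun k => e k < e ⟨1, hn2⟩).card at hcard
  have hle : (Finset.univ.filter fun k => e k < e ⟨1, hn2⟩).card ≤ 1 := by
    refine Finset.card_le_one.2 fun a ha b hb => ?_
    have hzero : ∀ k, e k < e ⟨1, hn2⟩ → k.val = 0 := by
      intro k hk
      have : k < ⟨1, hn2⟩ := hmono.reflect_lt hk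
      simpa [Fin.lt_def] using this
    exact Fin.ext ((hzero a (by simpa using ha)).trans (hzero b (by simpa using hb)).symm)
  rw [← hcard] at hle
  exact hij (Finset.card_le_one.1 hle j (by simpa using hj) i (by simpa using hi))

/-- Each eigenvalue of the eigenbasis is either the one attached to the all-ones vector or at least
the second-smallest root of the characteristic polynomial. -/
lemma eigenvectorBasis_dotProduct_eq_zero_or_le {n : ℕ} (hn2 : 2 ≤ n)
    {A : Matrix (Fin n) (Fin n) ℝ} (hA : A.IsHermitian) (hA1 : A.mulVec (fun _ => 1) = 0)
    {e : Fin n → ℝ} (hmono : Monotone e)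
    (hchar : A.charpoly = ∏ i, (Polynomial.X - Polynomial.C (e i)))
    (hev : ∀ i, 0 ≤ hA.eigenvalues i)
    {z : Fin n → ℝ} (hz : ∑ i, z i = 0) (i : Fin n) :
    (hA.eigenvectorBasis i).ofLp ⬝ᵥ z = 0 ∨ e ⟨1, hn2⟩ ≤ hA.eigenvalues i := by
  by_cases hi : e ⟨1, hn2⟩ ≤ hA.eigenvalues i
  · exact Or.inr hi
  push Not at hi
  left
  have hpos : 0 < e ⟨1, hn2⟩ := (hev i).trans_lt hi
  let u : EuclideanSpace ℝ (Fin n) := WithLp.toLp 2 fun _ => 1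
  have horth : ∀ j, j ≠ i → inner ℝ (hA.eigenvectorBasis j) u = 0 := by
    intro j hj
    have hjle : e ⟨1, hn2⟩ ≤ hA.eigenvalues j :=
      le_of_ne_of_lt_second_root hn2 hmono
        (by rw [← hchar, hA.charpoly_eq]; rfl) hj hi
    have h0 : hA.eigenvalues j * ((hA.eigenvectorBasis j).ofLp ⬝ᵥ fun _ => 1) = 0 := by
      have hsymm : Aᵀ = A := by simpa using hA.eq
      rw [← smul_eq_mul, ← smul_dotProduct, ← hA.mulVec_eigenvectorBasis, dotProduct_comm,
        dotProduct_mulVec, ← mulVec_transpose, hsymm, hA1, zero_dotProduct]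
    rw [EuclideanSpace.inner_eq_star_dotProduct, star_trivial, dotProduct_comm]
    exact (mul_eq_zero.1 h0).resolve_left (hpos.trans_le hjle).ne'
  have hu : inner ℝ (hA.eigenvectorBasis i) u • hA.eigenvectorBasis i = u := by
    rw [← Finset.sum_eq_single_of_mem
      (f := fun j => inner ℝ (hA.eigenvectorBasis j) u • hA.eigenvectorBasis j) i
      (Finset.mem_univ i) fun j _ hj => by rw [horth j hj, zero_smul]]
    exact hA.eigenvectorBasis.sum_repr' u
  have hprod : inner ℝ (hA.eigenvectorBasis i) u * ((hA.eigenvectorBasis i).ofLp ⬝ᵥ z) = 0 := by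
    rw [← smul_eq_mul, ← smul_dotProduct, ← WithLp.ofLp_smul, hu]
    simpa [u, dotProduct] using hz
  refine (mul_eq_zero.1 hprod).resolve_left fun h0 => ?_
  rw [h0, zero_smul] at hu
  have := congrArg (fun w : EuclideanSpace ℝ (Fin n) => w ⟨1, hn2⟩) hu
  simp [u] at this

lemma OrthonormalBasis.sum_sq_dotProduct {ι : Type*} [Fintype ι]
    (b : OrthonormalBasis ι ℝ (EuclideanSpace ℝ ι)) (z : ι → ℝ) :
    ∑ i, ((b i).ofLp ⬝ᵥ z) ^ 2 = ∑ i, z i ^ 2 := by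
  have h := b.sum_sq_norm_inner_right (WithLp.toLp 2 z)
  simpa [EuclideanSpace.inner_eq_star_dotProduct, EuclideanSpace.norm_sq_eq, dotProduct_comm]
    using h

/-- `T` consensus steps contract zero-sum vectors by `(1 - λ) ^ T`, with `λ` the second-smallest
root of the characteristic polynomial. -/
lemma sum_sq_one_sub_pow_mulVec_le {n : ℕ} (hn2 : 2 ≤ n)
    {A : Matrix (Fin n) (Fin n) ℝ} (hAsymm : A.IsSymm) (hA1 : A.mulVec (fun _ => 1) = 0)
    {e : Fin n → ℝ} (hmono : Monotone e)
    (hchar : A.charpoly = ∏ i, (Polynomial.X - Polynomial.C (e i)))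
    (he : ∀ i, 0 ≤ e i ∧ e i ≤ 1) {z : Fin n → ℝ} (hz : ∑ i, z i = 0) (T : ℕ) :
    ∑ i, (((1 - A) ^ T).mulVec z i) ^ 2 ≤ (1 - e ⟨1, hn2⟩) ^ (2 * T) * ∑ i, z i ^ 2 := by
  have hA : A.IsHermitian := (conjTranspose_eq_transpose_of_trivial A).trans hAsymm
  have hev : ∀ i, 0 ≤ hA.eigenvalues i ∧ hA.eigenvalues i ≤ 1 := by
    intro i
    have h0 : (∏ j, (Polynomial.X - Polynomial.C (e j))).eval (hA.eigenvalues i) = 0 := by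
      rw [← hchar, hA.charpoly_eq, Polynomial.eval_prod]
      exact Finset.prod_eq_zero (Finset.mem_univ i) (by simp)
    rw [Polynomial.eval_prod, Finset.prod_eq_zero_iff] at h0
    obtain ⟨j, -, hj⟩ := h0
    rw [Polynomial.eval_sub, Polynomial.eval_X, Polynomial.eval_C, sub_eq_zero] at hj
    exact hj ▸ he j
  have hpow : ∀ (t : ℕ) i, ((1 - A) ^ t).mulVec (hA.eigenvectorBasis i).ofLp =
      (1 - hA.eigenvalues i) ^ t • (hA.eigenvectorBasis i).ofLp := by
    intro t i
    induction t with
    | zero => simp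
    | succ t ih =>
      rw [pow_succ, ← mulVec_mulVec, sub_mulVec, one_mulVec, hA.mulVec_eigenvectorBasis,
        mulVec_sub, mulVec_smul, ih]
      module
  have hcoeff : ∀ i, (hA.eigenvectorBasis i).ofLp ⬝ᵥ ((1 - A) ^ T).mulVec z =
      (1 - hA.eigenvalues i) ^ T * ((hA.eigenvectorBasis i).ofLp ⬝ᵥ z) := by
    intro i
    have hsymm : ((1 - A) ^ T)ᵀ = (1 - A) ^ T := by
      rw [transpose_pow, transpose_sub, transpose_one, hAsymm.eq]
    rw [dotProduct_mulVec, ← mulVec_transpose, hsymm, hpow, smul_dotProduct, smul_eq_mul]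
  rw [← hA.eigenvectorBasis.sum_sq_dotProduct, ← hA.eigenvectorBasis.sum_sq_dotProduct z,
    Finset.mul_sum]
  refine Finset.sum_le_sum fun i _ => ?_
  rw [hcoeff, mul_pow, ← pow_mul, mul_comm T 2]
  rcases eigenvectorBasis_dotProduct_eq_zero_or_le hn2 hA hA1 hmono hchar
    (fun i => (hev i).1) hz i with h | h
  · simp [h]
  · have := (hev i).2
    gcongr

lemma sum_sq_sub_mean_le {n : ℕ} (hn : n ≠ 0) (y : Fin n → ℝ) :
    ∑ i, (y i - (∑ j, y j) / n) ^ 2 ≤ ∑ i, y i ^ 2 := by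
  have hn' : (n : ℝ) ≠ 0 := by exact_mod_cast hn
  have h : ∑ i, (y i - (∑ j, y j) / n) ^ 2 = ∑ i, y i ^ 2 - (∑ j, y j) ^ 2 / n := by
    simp only [sub_sq, Finset.sum_add_distrib, Finset.sum_sub_distrib, ← Finset.sum_mul,
      ← Finset.mul_sum, Finset.sum_const, Finset.card_univ, Fintype.card_fin, nsmul_eq_mul]
    field_simp
    ring
  rw [h]
  have : 0 ≤ (∑ j, y j) ^ 2 / (n : ℝ) := by positivity
  linarith

lemma sum_sq_mulVec_le {m k : Type*} [Fintype m] [Fintype k] (M : Matrix m k ℝ) (v : k → ℝ) :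
    ∑ i, (M.mulVec v i) ^ 2 ≤ (∑ i, ∑ j, M i j ^ 2) * ∑ j, v j ^ 2 := by
  rw [Finset.sum_mul]
  exact Finset.sum_le_sum fun i _ => Finset.sum_mul_sq_le_sq_mul_sq _ _ _

/-- Consensus error after `T` steps from an initial state `y` with coordinate sum `s`. -/
lemma sum_sq_consensus_error_le {n : ℕ} (hn2 : 2 ≤ n)
    {A : Matrix (Fin n) (Fin n) ℝ} (hAsymm : A.IsSymm) (hA1 : A.mulVec (fun _ => 1) = 0)
    {e : Fin n → ℝ} (hmono : Monotone e)
    (hchar : A.charpoly = ∏ i, (Polynomial.X - Polynomial.C (e i)))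
    (he : ∀ i, 0 ≤ e i ∧ e i ≤ 1) {y : Fin n → ℝ} {s : ℝ} (hs : ∑ i, y i = s) (T : ℕ) :
    ∑ i, (((1 - A) ^ T).mulVec y i - s / n) ^ 2 ≤
      (1 - e ⟨1, hn2⟩) ^ (2 * T) * ∑ i, y i ^ 2 := by
  have hn : (n : ℝ) ≠ 0 := by
    have : n ≠ 0 := by omega
    exact_mod_cast this
  have hone : ((1 - A) ^ T).mulVec (fun _ => s / n) = fun _ => s / n := by
    have hconst : A.mulVec (fun _ => s / n) = 0 := by
      have : (fun _ : Fin n => s / n) = (s / n) • fun _ => (1 : ℝ) := by ext; simp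
      rw [this, mulVec_smul, hA1, smul_zero]
    induction T with
    | zero => simp
    | succ t ih => rw [pow_succ, ← mulVec_mulVec, sub_mulVec, one_mulVec, hconst, sub_zero, ih]
  have hz : ∑ i, (y i - s / n) = 0 := by
    rw [Finset.sum_sub_distrib, hs]
    simp
    field_simp
    simp
  calc ∑ i, (((1 - A) ^ T).mulVec y i - s / n) ^ 2
      = ∑ i, (((1 - A) ^ T).mulVec (fun i => y i - s / n) i) ^ 2 := by
        have : (fun i => y i - s / n) = y - fun _ => s / n := rfl
        simp only [this, mulVec_sub, hone, Pi.sub_apply]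
    _ ≤ (1 - e ⟨1, hn2⟩) ^ (2 * T) * ∑ i, (y i - s / n) ^ 2 :=
        sum_sq_one_sub_pow_mulVec_le hn2 hAsymm hA1 hmono hchar he hz T
    _ ≤ _ :=
        mul_le_mul_of_nonneg_left (hs ▸ sum_sq_sub_mean_le (by omega) y)
          ((even_two_mul T).pow_nonneg _)

/-- A bounded function of one variable is uncorrelated with an independent centered variable. -/
lemma integrable_mul_and_integral_mul_eq_zero {Ω E : Type*} [MeasurableSpace Ω]
    [MeasurableSpace E] {P : Measure Ω} {X : Ω → E} {Y : Ω → ℝ} {f : E → ℝ}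
    (hX : Measurable X) (hf : Measurable f) (hY : Integrable Y P) (hXY : IndepFun X Y P)
    (hY0 : ∫ ω, Y ω ∂P = 0) {c : ℝ} (hc : ∀ᵐ ω ∂P, ‖f (X ω)‖ ≤ c) :
    Integrable (fun ω => f (X ω) * Y ω) P ∧ ∫ ω, f (X ω) * Y ω ∂P = 0 := by
  have hfX : AEStronglyMeasurable (fun ω => f (X ω)) P :=
    (hf.comp hX).aestronglyMeasurable
  refine ⟨hY.bdd_mul hfX hc, ?_⟩
  have hind : IndepFun (fun ω => f (X ω)) Y P := hXY.comp hf measurable_id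
  have h := hind.integral_mul_eq_mul_integral hfX hY.aestronglyMeasurable
  rw [hY0, mul_zero] at h
  exact h

lemma sum_sum_sq_le_of_sqrt_le {m k : Type*} [Fintype m] [Fintype k] {M : Matrix m k ℝ} {a : ℝ}
    (ha : 0 ≤ a) (h : Real.sqrt (∑ i, ∑ j, M i j ^ 2) ≤ Real.sqrt a) :
    ∑ i, ∑ j, M i j ^ 2 ≤ a :=
  (Real.sqrt_le_sqrt_iff ha).1 h

lemma sq_entry_le_sum_sum_sq {m k : Type*} [Fintype m] [Fintype k] (M : Matrix m k ℝ) (i : m)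
    (j : k) : M i j ^ 2 ≤ ∑ i, ∑ j, M i j ^ 2 :=
  (Finset.single_le_sum (f := fun j => M i j ^ 2) (fun _ _ => sq_nonneg _)
    (Finset.mem_univ j)).trans
    (Finset.single_le_sum (f := fun i => ∑ j, M i j ^ 2)
      (fun _ _ => Finset.sum_nonneg fun _ _ => sq_nonneg _) (Finset.mem_univ i))

lemma measurable_matrix_entry {m k : Type*} (i : m) (j : k) :
    Measurable fun M : Matrix m k ℝ => M i j :=
  (measurable_pi_apply j).comp (measurable_pi_apply (X := fun _ : m => k → ℝ) i)

/-- Lemma 3 (Lemma B) of the paper: mean-square error of the PPSC-Gossip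
averaging consensus algorithm.  `C, D` are the random matrices of the `S`-step
multi-gossiping PPSC mechanism over a private graph with `q` components, `γ`
collects the `qS` independent noises (centered, total variance `≤ qSσ²`,
independent of `(C, D)`), and `A` is the symmetric consensus (Laplacian)
matrix with `A𝟙 = 0`, eigenvalues `e 0 ≤ e 1 ≤ … ≤ e (n-1)` in `[0,1]`
(the roots with multiplicity of its characteristic polynomial) and
second-smallest eigenvalue `λ_G = e 1`. -/
theorem stmt7 (n q S : ℕ) (hn2 : 2 ≤ n) (hq : 1 ≤ q) (hS : 1 ≤ S)
    (σ : ℝ) (hσ : 0 < σ)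
    {Ω : Type*} [MeasurableSpace Ω] (P : Measure Ω) [IsProbabilityMeasure P]
    (C : Ω → Matrix (Fin n) (Fin n) ℝ) (D : Ω → Matrix (Fin n) (Fin (q * S)) ℝ)
    (γ : Ω → Fin (q * S) → ℝ)
    (hCm : Measurable C) (hDm : Measurable D) (hγm : Measurable γ)
    (hγ2 : Integrable (fun ω => ∑ i, (γ ω i) ^ 2) P)
    (hindep : IndepFun (fun ω => (C ω, D ω)) γ P)
    (hγ0 : ∀ i, ∫ ω, γ ω i ∂P = 0)
    (hγvar : ∫ ω, ∑ i, (γ ω i) ^ 2 ∂P ≤ q * S * σ ^ 2)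
    (hCF : ∀ᵐ ω ∂P, Real.sqrt (∑ i, ∑ j, (C ω i j) ^ 2) ≤ Real.sqrt n)
    (hDF : ∀ᵐ ω ∂P, Real.sqrt (∑ i, ∑ j, (D ω i j) ^ 2) ≤ Real.sqrt (2 * q * S))
    (hC1 : ∀ᵐ ω ∂P, ∀ j, ∑ i, C ω i j = 1)
    (hD1 : ∀ᵐ ω ∂P, ∀ j, ∑ i, D ω i j = 0)
    (A : Matrix (Fin n) (Fin n) ℝ) (hAsymm : A.IsSymm)
    (hA1 : A.mulVec (fun _ => 1) = 0)
    (e : Fin n → ℝ) (hmono : Monotone e)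
    (hchar : A.charpoly = ∏ i, (Polynomial.X - Polynomial.C (e i)))
    (he : ∀ i, 0 ≤ e i ∧ e i ≤ 1)
    (lamG : ℝ) (hlamG : lamG = e ⟨1, hn2⟩) :
    ∀ (x₀ : Fin n → ℝ) (T : ℕ),
      ∫ ω, ∑ i, ((((1 : Matrix (Fin n) (Fin n) ℝ) - A) ^ T).mulVec
            ((C ω).mulVec x₀ + (D ω).mulVec (γ ω)) i - (∑ j, x₀ j) / n) ^ 2 ∂P
        ≤ ((n : ℝ) * ∑ i, (x₀ i) ^ 2 + 2 * q ^ 2 * S ^ 2 * σ ^ 2) *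
            (1 - lamG) ^ (2 * T) := by
  intro x₀ T
  have hγi : ∀ k, Integrable (fun ω => γ ω k) P := by
    intro k
    have hm : Measurable fun ω => γ ω k := (measurable_pi_apply k).comp hγm
    have h2 : Integrable (fun ω => (γ ω k) ^ 2) P := by
      refine hγ2.mono' (hm.pow_const 2).aestronglyMeasurable (ae_of_all _ fun ω => ?_)
      rw [Real.norm_of_nonneg (sq_nonneg _)]
      exact Finset.single_le_sum (f := fun k => γ ω k ^ 2) (fun _ _ => sq_nonneg _)
        (Finset.mem_univ k)
    exact ((memLp_two_iff_integrable_sq hm.aestronglyMeasurable).2 h2).integrable one_le_two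
  have hC2 : ∀ᵐ ω ∂P, ∑ i, ∑ j, (C ω i j) ^ 2 ≤ n :=
    hCF.mono fun ω h => sum_sum_sq_le_of_sqrt_le (by positivity) h
  have hD2 : ∀ᵐ ω ∂P, ∑ i, ∑ j, (D ω i j) ^ 2 ≤ 2 * q * S :=
    hDF.mono fun ω h => sum_sum_sq_le_of_sqrt_le (by positivity) h
  have hCx : ∀ᵐ ω ∂P, ∑ i, ((C ω).mulVec x₀ i) ^ 2 ≤ n * ∑ i, x₀ i ^ 2 := by
    filter_upwards [hC2] with ω h
    exact (sum_sq_mulVec_le _ _).trans (by gcongr)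
  have hcross : ∀ i k, Integrable (fun ω => (C ω).mulVec x₀ i * D ω i k * γ ω k) P ∧
      ∫ ω, (C ω).mulVec x₀ i * D ω i k * γ ω k ∂P = 0 := by
    intro i k
    refine integrable_mul_and_integral_mul_eq_zero (X := fun ω => (C ω, D ω))
      (f := fun M => M.1.mulVec x₀ i * M.2 i k)
      (c := (n * ∑ i, x₀ i ^ 2) + 2 * q * S) (hCm.prodMk hDm) ?_ (hγi k)
      (hindep.comp measurable_id (measurable_pi_apply k)) (hγ0 k) ?_
    · refine Measurable.mul ?_ ((measurable_matrix_entry i k).comp measurable_snd)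
      simp only [mulVec, dotProduct]
      exact Finset.measurable_fun_sum _ fun j _ =>
        ((measurable_matrix_entry i j).comp measurable_fst).mul_const _
    · filter_upwards [hCx, hD2] with ω h1 h2
      have h1' : ((C ω).mulVec x₀ i) ^ 2 ≤ n * ∑ i, x₀ i ^ 2 :=
        (Finset.single_le_sum (f := fun i => ((C ω).mulVec x₀ i) ^ 2)
          (fun _ _ => sq_nonneg _) (Finset.mem_univ i)).trans h1
      have h2' := (sq_entry_le_sum_sum_sq (D ω) i k).trans h2
      rw [Real.norm_eq_abs, abs_le]
      constructor <;>
        nlinarith [sq_nonneg ((C ω).mulVec x₀ i + D ω i k),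
          sq_nonneg ((C ω).mulVec x₀ i - D ω i k), sq_nonneg ((C ω).mulVec x₀ i),
          sq_nonneg (D ω i k)]
  have hcross_int : Integrable
      (fun ω => ∑ i, ∑ k, (C ω).mulVec x₀ i * D ω i k * γ ω k) P :=
    integrable_finsetSum _ fun i _ => integrable_finsetSum _ fun k _ => (hcross i k).1
  have hcross_zero : ∫ ω, ∑ i, ∑ k, (C ω).mulVec x₀ i * D ω i k * γ ω k ∂P = 0 := by
    rw [integral_finsetSum _ fun i _ => integrable_finsetSum _ fun k _ => (hcross i k).1]
    refine Finset.sum_eq_zero fun i _ => ?_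
    rw [integral_finsetSum _ fun k _ => (hcross i k).1]
    exact Finset.sum_eq_zero fun k _ => (hcross i k).2
  have hr : 0 ≤ (1 - lamG) ^ (2 * T) := (even_two_mul T).pow_nonneg _
  have hbound : ∀ᵐ ω ∂P, ∑ i, ((((1 : Matrix (Fin n) (Fin n) ℝ) - A) ^ T).mulVec
        ((C ω).mulVec x₀ + (D ω).mulVec (γ ω)) i - (∑ j, x₀ j) / n) ^ 2 ≤
      (1 - lamG) ^ (2 * T) * (n * ∑ i, x₀ i ^ 2 +
        2 * ∑ i, ∑ k, (C ω).mulVec x₀ i * D ω i k * γ ω k +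
        2 * q * S * ∑ k, (γ ω k) ^ 2) := by
    filter_upwards [hCx, hD2, hC1, hD1] with ω h1 h2 h3 h4
    have hsum : ∑ i, ((C ω).mulVec x₀ + (D ω).mulVec (γ ω)) i = ∑ j, x₀ j := by
      simp only [Pi.add_apply, Finset.sum_add_distrib, mulVec, dotProduct]
      rw [Finset.sum_comm, Finset.sum_comm (f := fun i k => D ω i k * γ ω k)]
      simp [← Finset.sum_mul, h3, h4]
    refine (sum_sq_consensus_error_le hn2 hAsymm hA1 hmono hchar he hsum T).trans ?_
    rw [← hlamG]
    refine mul_le_mul_of_nonneg_left ?_ hr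
    have h5 : ∑ i, ((D ω).mulVec (γ ω) i) ^ 2 ≤ 2 * q * S * ∑ k, (γ ω k) ^ 2 :=
      (sum_sq_mulVec_le _ _).trans (by gcongr)
    have h6 : ∑ i, ∑ k, (C ω).mulVec x₀ i * D ω i k * γ ω k =
        ∑ i, (C ω).mulVec x₀ i * (D ω).mulVec (γ ω) i := by
      refine Finset.sum_congr rfl fun i _ => ?_
      rw [show (D ω).mulVec (γ ω) i = ∑ k, D ω i k * γ ω k from rfl, Finset.mul_sum]
      exact Finset.sum_congr rfl fun k _ => mul_assoc _ _ _
    have h7 : ∑ i, (((C ω).mulVec x₀ + (D ω).mulVec (γ ω)) i) ^ 2 =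
        ∑ i, ((C ω).mulVec x₀ i) ^ 2 + 2 * ∑ i, (C ω).mulVec x₀ i * (D ω).mulVec (γ ω) i +
          ∑ i, ((D ω).mulVec (γ ω) i) ^ 2 := by
      rw [Finset.mul_sum, ← Finset.sum_add_distrib, ← Finset.sum_add_distrib]
      exact Finset.sum_congr rfl fun i _ => by rw [Pi.add_apply]; ring
    rw [h7, h6]
    linarith
  have hint1 : Integrable (fun ω => n * ∑ i, x₀ i ^ 2 +
      2 * ∑ i, ∑ k, (C ω).mulVec x₀ i * D ω i k * γ ω k) P :=
    (integrable_const _).add (hcross_int.const_mul 2)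
  have hint2 : Integrable (fun ω => 2 * q * S * ∑ k, (γ ω k) ^ 2) P := hγ2.const_mul _
  refine (integral_mono_of_nonneg (ae_of_all _ fun ω => Finset.sum_nonneg fun i _ => sq_nonneg _)
    ((hint1.add hint2).const_mul _) hbound).trans ?_
  simp only [Pi.add_apply]
  rw [integral_const_mul, integral_add hint1 hint2,
    integral_add (integrable_const _) (hcross_int.const_mul 2), integral_const_mul 2,
    integral_const_mul (2 * q * S : ℝ), hcross_zero, integral_const, probReal_univ, one_smul,
    mul_comm]
  refine mul_le_mul_of_nonneg_right ?_ hr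
  have : 2 * q * S * ∫ ω, ∑ i, (γ ω i) ^ 2 ∂P ≤ 2 * q * S * (q * S * σ ^ 2) := by gcongr
  linarith
end

section
/- Fix integers n, q, S ≥ 1 and a real σ > 0. Let (Ω, F, P) be a probability space carrying measurable random matrices C: Ω → ℝ^{n×n} and D: Ω → ℝ^{n×(qS)} and a square-integrable random vector γ: Ω → ℝ^{qS} that is independent of the pair (C, D), with E[γ] = 0 and E‖γ‖² ≤ qSσ², and almost surely ‖C‖_F ≤ √n, ‖D‖_F ≤ √(2qS), 𝟙ₙᵀC = 𝟙ₙᵀ, 𝟙ₙᵀD = 0. Let A ∈ ℝ^{n×n} be symmetric with A𝟙ₙ = 0, all eigenvalues in [0, 1], and second-smallest eigenvalue λ_G satisfying 0 < λ_G < 1. Let x₀ ∈ ℝⁿ with n‖x₀‖² + 2q²S²σ² > 0 and let ν > 0. If the integer T satisfies T ≥ (log ν − log(n‖x₀‖² + 2q²S²σ²))/(2 log(1 − λ_G)), then E‖(I − A)^T (C x₀ + D γ) − (1/n)𝟙ₙ𝟙ₙᵀx₀‖² ≤ ν. -/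
open MeasureTheory ProbabilityTheory Matrix

open Finset in
/-- If `e` is monotone, then any family `μ` with the same root polynomial `∏ i, (X - e i)` has at most
one entry below `e 1`. -/
theorem card_filter_lt_le_one_of_prod_X_sub_C_eq {n : ℕ} (hn : 2 ≤ n) {e μ : Fin n → ℝ}
    (hmono : Monotone e)
    (h : ∏ i, (Polynomial.X - Polynomial.C (e i)) = ∏ i, (Polynomial.X - Polynomial.C (μ i))) :
    #{i | μ i < e ⟨1, hn⟩} ≤ 1 := by
  have hroots : univ.val.map e = univ.val.map μ := by
    have := congrArg Polynomial.roots h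
    simpa [Polynomial.roots_prod, Finset.prod_ne_zero_iff, Polynomial.X_sub_C_ne_zero] using this
  have hcount := congrArg (Multiset.countP (· < e ⟨1, hn⟩)) hroots
  rw [Multiset.countP_map, Multiset.countP_map] at hcount
  change #{i | e i < e ⟨1, hn⟩} = #{i | μ i < e ⟨1, hn⟩} at hcount
  rw [← hcount, card_le_one]
  have key : ∀ i, e i < e ⟨1, hn⟩ → i.val = 0 := by
    intro i hi
    by_contra h0
    have h1 : (⟨1, hn⟩ : Fin n) ≤ i := Nat.one_le_iff_ne_zero.mpr h0
    exact (hmono h1).not_gt hi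
  intro i hi j hj
  simp only [mem_filter, mem_univ, true_and] at hi hj
  exact Fin.ext ((key i hi).trans (key j hj).symm)

section Hermitian

variable {ι : Type*} [Fintype ι] [DecidableEq ι] {A : Matrix ι ι ℝ}

theorem Matrix.IsHermitian.sum_dotProduct_mul_dotProduct_eigenvectorBasis (hA : A.IsHermitian)
    (u w : ι → ℝ) :
    ∑ i, (u ⬝ᵥ ⇑(hA.eigenvectorBasis i)) * (w ⬝ᵥ ⇑(hA.eigenvectorBasis i)) = u ⬝ᵥ w := by
  have h := hA.eigenvectorBasis.sum_inner_mul_inner (WithLp.toLp 2 u) (WithLp.toLp 2 w)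
  simp only [EuclideanSpace.inner_eq_star_dotProduct, star_trivial] at h
  rw [dotProduct_comm u w, ← h]
  exact Finset.sum_congr rfl fun i _ => by rw [dotProduct_comm u]

theorem Matrix.IsHermitian.mulVec_dotProduct_eigenvectorBasis (hA : A.IsHermitian)
    (w : ι → ℝ) (i : ι) :
    (A *ᵥ w) ⬝ᵥ ⇑(hA.eigenvectorBasis i) =
      hA.eigenvalues i * (w ⬝ᵥ ⇑(hA.eigenvectorBasis i)) := by
  have hT : Aᵀ = A := by simpa using hA.eq
  rw [dotProduct_comm, dotProduct_mulVec, ← mulVec_transpose, hT, hA.mulVec_eigenvectorBasis,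
    smul_dotProduct, smul_eq_mul, dotProduct_comm]

/-- A vector orthogonal to a nonzero kernel vector `u` of `A` is orthogonal to the only eigenvector
whose eigenvalue lies below a positive `l`. -/
theorem Matrix.IsHermitian.dotProduct_eigenvectorBasis_eq_zero (hA : A.IsHermitian) {l : ℝ}
    (hl : 0 < l) (hcard : (Finset.univ.filter fun i => hA.eigenvalues i < l).card ≤ 1)
    {u w : ι → ℝ} (hu0 : u ≠ 0) (hu : A *ᵥ u = 0) (huw : u ⬝ᵥ w = 0) {i : ι}
    (hi : hA.eigenvalues i < l) : w ⬝ᵥ ⇑(hA.eigenvectorBasis i) = 0 := by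
  have hne : ∀ j, j ≠ i → u ⬝ᵥ ⇑(hA.eigenvectorBasis j) = 0 := by
    intro j hj
    have hlj : l ≤ hA.eigenvalues j := by
      by_contra! h
      exact hj (Finset.card_le_one.mp hcard j (by simpa using h) i (by simpa using hi))
    have h := hA.mulVec_dotProduct_eigenvectorBasis u j
    rw [hu, zero_dotProduct] at h
    exact (mul_eq_zero.mp h.symm).resolve_left (hl.trans_le hlj).ne'
  have hsum : ∀ z : ι → ℝ, u ⬝ᵥ z =
      (u ⬝ᵥ ⇑(hA.eigenvectorBasis i)) * (z ⬝ᵥ ⇑(hA.eigenvectorBasis i)) := by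
    intro z
    rw [← hA.sum_dotProduct_mul_dotProduct_eigenvectorBasis]
    exact Finset.sum_eq_single i (fun j _ hj => by rw [hne j hj, zero_mul]) (by simp)
  refine (mul_eq_zero.mp ((hsum w).symm.trans huw)).resolve_left fun h => hu0 ?_
  have := hsum u
  rwa [h, zero_mul, dotProduct_self_eq_zero] at this

/-- One consensus step contracts the orthogonal complement of a kernel vector. -/
theorem Matrix.IsHermitian.one_sub_mulVec_dotProduct_self_le (hA : A.IsHermitian) {l : ℝ}
    (hl : 0 < l) (hcard : (Finset.univ.filter fun i => hA.eigenvalues i < l).card ≤ 1)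
    (hle : ∀ i, hA.eigenvalues i ≤ 1)
    {u w : ι → ℝ} (hu0 : u ≠ 0) (hu : A *ᵥ u = 0) (huw : u ⬝ᵥ w = 0) :
    ((1 - A) *ᵥ w) ⬝ᵥ ((1 - A) *ᵥ w) ≤ (1 - l) ^ 2 * (w ⬝ᵥ w) := by
  rw [← hA.sum_dotProduct_mul_dotProduct_eigenvectorBasis,
    ← hA.sum_dotProduct_mul_dotProduct_eigenvectorBasis w, Finset.mul_sum]
  refine Finset.sum_le_sum fun i _ => ?_
  rw [sub_mulVec, one_mulVec, sub_dotProduct, hA.mulVec_dotProduct_eigenvectorBasis]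
  rcases lt_or_ge (hA.eigenvalues i) l with hi | hi
  · simp [hA.dotProduct_eigenvectorBasis_eq_zero hl hcard hu0 hu huw hi]
  · have h : (1 - hA.eigenvalues i) ^ 2 ≤ (1 - l) ^ 2 :=
      pow_le_pow_left₀ (by linarith [hle i]) (by linarith) 2
    nlinarith [mul_le_mul_of_nonneg_right h (sq_nonneg (w ⬝ᵥ ⇑(hA.eigenvectorBasis i)))]

theorem Matrix.IsHermitian.one_sub_pow_mulVec_dotProduct_self_le (hA : A.IsHermitian) {l : ℝ}
    (hl : 0 < l) (hcard : (Finset.univ.filter fun i => hA.eigenvalues i < l).card ≤ 1)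
    (hle : ∀ i, hA.eigenvalues i ≤ 1)
    {u w : ι → ℝ} (hu0 : u ≠ 0) (hu : A *ᵥ u = 0) (huw : u ⬝ᵥ w = 0) (T : ℕ) :
    ((1 - A) ^ T *ᵥ w) ⬝ᵥ ((1 - A) ^ T *ᵥ w) ≤ ((1 - l) ^ 2) ^ T * (w ⬝ᵥ w) := by
  induction T generalizing w with
  | zero => simp
  | succ T ih =>
    have hT : Aᵀ = A := by simpa using hA.eq
    have hstep : u ⬝ᵥ ((1 - A) *ᵥ w) = 0 := by
      rw [sub_mulVec, one_mulVec, dotProduct_sub, huw, dotProduct_mulVec, ← mulVec_transpose, hT,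
        hu, zero_dotProduct, sub_zero]
    rw [pow_succ, ← mulVec_mulVec]
    calc _ ≤ _ := ih hstep
      _ ≤ ((1 - l) ^ 2) ^ T * ((1 - l) ^ 2 * (w ⬝ᵥ w)) := by
        gcongr
        exact hA.one_sub_mulVec_dotProduct_self_le hl hcard hle hu0 hu huw
      _ = _ := by ring

end Hermitian

/-- The mean-square deviation of consensus iterates from the average decays geometrically. -/
theorem sum_one_sub_pow_mulVec_sub_average_sq_le {n : ℕ} (hn : 2 ≤ n)
    {A : Matrix (Fin n) (Fin n) ℝ} (hA : A.IsSymm) (hA1 : A *ᵥ (fun _ => 1) = 0)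
    {e : Fin n → ℝ} (hmono : Monotone e)
    (hchar : A.charpoly = ∏ i, (Polynomial.X - Polynomial.C (e i)))
    (he : ∀ i, e i ≤ 1) (hpos : 0 < e ⟨1, hn⟩) (T : ℕ) (y : Fin n → ℝ) :
    ∑ i, (((1 - A) ^ T *ᵥ y) i - (∑ j, y j) / n) ^ 2 ≤
      ((1 - e ⟨1, hn⟩) ^ 2) ^ T * ∑ i, y i ^ 2 := by
  have hH : A.IsHermitian := (conjTranspose_eq_transpose_of_trivial A).trans hA
  have hprod : ∏ i, (Polynomial.X - Polynomial.C (e i)) =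
      ∏ i, (Polynomial.X - Polynomial.C (hH.eigenvalues i)) := by
    rw [← hchar, hH.charpoly_eq]; rfl
  have hle : ∀ i, hH.eigenvalues i ≤ 1 := by
    intro i
    have h0 : (∏ j, (Polynomial.X - Polynomial.C (e j))).eval (hH.eigenvalues i) = 0 := by
      rw [hprod, Polynomial.eval_prod]
      exact Finset.prod_eq_zero (Finset.mem_univ i) (by simp)
    rw [Polynomial.eval_prod, Finset.prod_eq_zero_iff] at h0
    obtain ⟨j, -, hj⟩ := h0
    have : hH.eigenvalues i = e j := by simpa [sub_eq_zero] using hj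
    exact this ▸ he j
  have hn0 : (n : ℝ) ≠ 0 := by positivity
  set c : ℝ := (∑ j, y j) / n with hc
  set w : Fin n → ℝ := y - c • fun _ => 1 with hw
  have hcn : (n : ℝ) * c = ∑ j, y j := by rw [hc]; field_simp
  have huw : (fun _ => (1 : ℝ)) ⬝ᵥ w = 0 := by
    simp [hw, dotProduct, Finset.sum_sub_distrib, hcn]
  have hu0 : (fun _ : Fin n => (1 : ℝ)) ≠ 0 := fun h => one_ne_zero (congrFun h ⟨1, hn⟩)
  have hfix : (1 - A) ^ T *ᵥ (fun _ => (1 : ℝ)) = fun _ => 1 := by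
    induction T with
    | zero => simp
    | succ T ih => rw [pow_succ, ← mulVec_mulVec, sub_mulVec, one_mulVec, hA1, sub_zero, ih]
  have key := hH.one_sub_pow_mulVec_dotProduct_self_le hpos
    (card_filter_lt_le_one_of_prod_X_sub_C_eq hn hmono hprod) hle hu0 hA1 huw T
  have hlhs : (1 - A) ^ T *ᵥ w = (1 - A) ^ T *ᵥ y - c • fun _ => 1 := by
    rw [hw, mulVec_sub, mulVec_smul, hfix]
  have hww : w ⬝ᵥ w ≤ ∑ i, y i ^ 2 := by
    have : w ⬝ᵥ w = ∑ i, y i ^ 2 - n * c ^ 2 := by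
      have : w ⬝ᵥ w = ∑ i, (y i ^ 2 - 2 * c * y i + c ^ 2) :=
        Finset.sum_congr rfl fun i _ => by simp [hw]; ring
      rw [this, Finset.sum_add_distrib, Finset.sum_sub_distrib, ← Finset.mul_sum, ← hcn]
      simp; ring
    rw [this]
    have : 0 ≤ (n : ℝ) * c ^ 2 := by positivity
    linarith
  calc _ = ((1 - A) ^ T *ᵥ w) ⬝ᵥ ((1 - A) ^ T *ᵥ w) := by
        rw [hlhs]; exact Finset.sum_congr rfl fun i _ => by simp [sq]
    _ ≤ _ := key
    _ ≤ _ := by gcongr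

theorem Matrix.sum_mulVec_sq_le {m k : Type*} [Fintype m] [Fintype k] (M : Matrix m k ℝ)
    (x : k → ℝ) : ∑ i, (M *ᵥ x) i ^ 2 ≤ (∑ i, ∑ j, M i j ^ 2) * ∑ j, x j ^ 2 := by
  rw [Finset.sum_mul]
  exact Finset.sum_le_sum fun i _ => Finset.sum_mul_sq_le_sq_mul_sq _ _ _

/-- Cross terms between a bounded random variable and an independent centred one vanish. -/
theorem ProbabilityTheory.IndepFun.integrable_and_integral_mul_eq_zero {Ω : Type*}
    [MeasurableSpace Ω] {P : Measure Ω} [IsProbabilityMeasure P] {X Y : Ω → ℝ}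
    (h : IndepFun X Y P) (hX : Measurable X) {K : ℝ} (hK : ∀ᵐ ω ∂P, |X ω| ≤ K)
    (hY : Integrable Y P) (hY0 : ∫ ω, Y ω ∂P = 0) :
    Integrable (fun ω => X ω * Y ω) P ∧ ∫ ω, X ω * Y ω ∂P = 0 := by
  have hXi : Integrable X P := Integrable.of_bound hX.aestronglyMeasurable K hK
  refine ⟨h.integrable_mul hXi hY, ?_⟩
  rw [h.integral_fun_mul_eq_mul_integral hXi.aestronglyMeasurable hY.aestronglyMeasurable, hY0,
    mul_zero]

theorem one_sub_sq_pow_mul_le_of_log_le {l M ν : ℝ} (hl0 : 0 < l) (hl1 : l < 1) (hM : 0 < M)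
    (hν : 0 < ν) {T : ℕ} (hT : (Real.log ν - Real.log M) / (2 * Real.log (1 - l)) ≤ T) :
    ((1 - l) ^ 2) ^ T * M ≤ ν := by
  have hl : 0 < 1 - l := by linarith
  have hlog : Real.log (1 - l) < 0 := Real.log_neg hl (by linarith)
  rw [div_le_iff_of_neg (by linarith)] at hT
  rw [← Real.log_le_log_iff (by positivity) hν, Real.log_mul (by positivity) hM.ne', Real.log_pow,
    Real.log_pow]
  push_cast
  linarith

/-- Accuracy statement (ii) of Theorem 2 of the paper: under the PPSC
hypotheses on the random matrices `C, D` and noise `γ`, if the number `T` of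
averaging-consensus steps satisfies
`T ≥ (log ν − log(n‖x₀‖² + 2q²S²σ²))/(2 log(1 − λ_G))`, then the PPSC-Gossip
averaging consensus output is within `ν` of the exact average in mean
square.  Here `A` is the symmetric consensus matrix with `A𝟙 = 0`, whose
eigenvalues (roots with multiplicity `e 0 ≤ … ≤ e (n-1)` of its characteristic
polynomial) lie in `[0,1]`, and `λ_G = e 1 ∈ (0,1)` is the second-smallest
eigenvalue. -/
theorem stmt8 (n q S : ℕ) (hn2 : 2 ≤ n) (hq : 1 ≤ q) (hS : 1 ≤ S)
    (σ : ℝ) (hσ : 0 < σ)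
    {Ω : Type*} [MeasurableSpace Ω] (P : Measure Ω) [IsProbabilityMeasure P]
    (C : Ω → Matrix (Fin n) (Fin n) ℝ) (D : Ω → Matrix (Fin n) (Fin (q * S)) ℝ)
    (γ : Ω → Fin (q * S) → ℝ)
    (hCm : Measurable C) (hDm : Measurable D) (hγm : Measurable γ)
    (hγ2 : Integrable (fun ω => ∑ i, (γ ω i) ^ 2) P)
    (hindep : IndepFun (fun ω => (C ω, D ω)) γ P)
    (hγ0 : ∀ i, ∫ ω, γ ω i ∂P = 0)
    (hγvar : ∫ ω, ∑ i, (γ ω i) ^ 2 ∂P ≤ q * S * σ ^ 2)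
    (hCF : ∀ᵐ ω ∂P, Real.sqrt (∑ i, ∑ j, (C ω i j) ^ 2) ≤ Real.sqrt n)
    (hDF : ∀ᵐ ω ∂P, Real.sqrt (∑ i, ∑ j, (D ω i j) ^ 2) ≤ Real.sqrt (2 * q * S))
    (hC1 : ∀ᵐ ω ∂P, ∀ j, ∑ i, C ω i j = 1)
    (hD1 : ∀ᵐ ω ∂P, ∀ j, ∑ i, D ω i j = 0)
    (A : Matrix (Fin n) (Fin n) ℝ) (hAsymm : A.IsSymm)
    (hA1 : A.mulVec (fun _ => 1) = 0)
    (e : Fin n → ℝ) (hmono : Monotone e)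
    (hchar : A.charpoly = ∏ i, (Polynomial.X - Polynomial.C (e i)))
    (he : ∀ i, 0 ≤ e i ∧ e i ≤ 1)
    (lamG : ℝ) (hlamG : lamG = e ⟨1, hn2⟩) (hlamG0 : 0 < lamG) (hlamG1 : lamG < 1)
    (x₀ : Fin n → ℝ) (hx₀ : 0 < (n : ℝ) * ∑ i, (x₀ i) ^ 2 + 2 * q ^ 2 * S ^ 2 * σ ^ 2)
    (ν : ℝ) (hν : 0 < ν) (T : ℕ)
    (hT : (T : ℝ) ≥ (Real.log ν -
        Real.log ((n : ℝ) * ∑ i, (x₀ i) ^ 2 + 2 * q ^ 2 * S ^ 2 * σ ^ 2)) /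
        (2 * Real.log (1 - lamG))) :
    ∫ ω, ∑ i, ((((1 : Matrix (Fin n) (Fin n) ℝ) - A) ^ T).mulVec
          ((C ω).mulVec x₀ + (D ω).mulVec (γ ω)) i - (∑ j, x₀ j) / n) ^ 2 ∂P ≤ ν := by
  set M := (n : ℝ) * ∑ i, (x₀ i) ^ 2 + 2 * q ^ 2 * S ^ 2 * σ ^ 2 with hM
  set r : ℝ := ((1 - lamG) ^ 2) ^ T with hr
  have hr0 : 0 ≤ r := by positivity
  have hrM : r * M ≤ ν := one_sub_sq_pow_mul_le_of_log_le hlamG0 hlamG1 hx₀ hν hT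
  have hCF' : ∀ᵐ ω ∂P, ∑ i, ∑ j, (C ω i j) ^ 2 ≤ n := by
    filter_upwards [hCF] with ω h
    exact (Real.sqrt_le_sqrt_iff (by positivity)).mp h
  have hDF' : ∀ᵐ ω ∂P, ∑ i, ∑ j, (D ω i j) ^ 2 ≤ 2 * q * S := by
    filter_upwards [hDF] with ω h
    exact (Real.sqrt_le_sqrt_iff (by positivity)).mp h
  have hγi : ∀ k, Integrable (fun ω => γ ω k) P := by
    intro k
    refine ((integrable_const (1 : ℝ)).add hγ2).mono'
      ((measurable_pi_apply k).comp hγm).aestronglyMeasurable (ae_of_all _ fun ω => ?_)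
    have h : γ ω k ^ 2 ≤ ∑ i, γ ω i ^ 2 :=
      Finset.single_le_sum (f := fun i => γ ω i ^ 2) (fun i _ => sq_nonneg _) (Finset.mem_univ k)
    rw [Real.norm_eq_abs]
    simp only [Pi.add_apply]
    nlinarith [sq_abs (γ ω k), sq_nonneg (|γ ω k| - 1), abs_nonneg (γ ω k)]
  have hcross : ∀ i k, Integrable (fun ω => ((C ω *ᵥ x₀) i * D ω i k) * γ ω k) P ∧
      ∫ ω, ((C ω *ᵥ x₀) i * D ω i k) * γ ω k ∂P = 0 := by
    intro i k
    have hφ : Measurable fun p : Matrix (Fin n) (Fin n) ℝ × Matrix (Fin n) (Fin (q * S)) ℝ =>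
        (p.1 *ᵥ x₀) i * p.2 i k := by
      have hC' : ∀ j, Measurable fun p : Matrix (Fin n) (Fin n) ℝ ×
          Matrix (Fin n) (Fin (q * S)) ℝ => p.1 i j := fun j =>
        (measurable_pi_apply j).comp ((measurable_pi_apply i).comp measurable_fst)
      have hD' : Measurable fun p : Matrix (Fin n) (Fin n) ℝ ×
          Matrix (Fin n) (Fin (q * S)) ℝ => p.2 i k :=
        (measurable_pi_apply k).comp ((measurable_pi_apply i).comp measurable_snd)
      have hCx : Measurable fun p : Matrix (Fin n) (Fin n) ℝ ×
          Matrix (Fin n) (Fin (q * S)) ℝ => (p.1 *ᵥ x₀) i :=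
        Finset.measurable_fun_sum Finset.univ fun j _ => (hC' j).mul_const (x₀ j)
      exact hCx.mul hD'
    refine (hindep.comp hφ (measurable_pi_apply k)).integrable_and_integral_mul_eq_zero
      (K := √((n * ∑ j, x₀ j ^ 2) * (2 * q * S))) (hφ.comp (hCm.prodMk hDm)) ?_ (hγi k) (hγ0 k)
    filter_upwards [hCF', hDF'] with ω hc hd
    refine Real.abs_le_sqrt ?_
    simp only [Function.comp_apply, mul_pow]
    refine mul_le_mul ?_ ?_ (sq_nonneg _) (by positivity)
    · calc (C ω *ᵥ x₀) i ^ 2 ≤ ∑ i, (C ω *ᵥ x₀) i ^ 2 :=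
            Finset.single_le_sum (f := fun i => (C ω *ᵥ x₀) i ^ 2) (fun i _ => sq_nonneg _)
              (Finset.mem_univ i)
        _ ≤ _ := (C ω).sum_mulVec_sq_le x₀
        _ ≤ _ := by gcongr
    · calc D ω i k ^ 2 ≤ ∑ k, D ω i k ^ 2 :=
            Finset.single_le_sum (f := fun k => D ω i k ^ 2) (fun i _ => sq_nonneg _)
              (Finset.mem_univ k)
        _ ≤ ∑ i, ∑ k, D ω i k ^ 2 :=
            Finset.single_le_sum (f := fun i => ∑ k, D ω i k ^ 2) (fun i _ => by positivity)
              (Finset.mem_univ i)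
        _ ≤ _ := hd
  let cross : Ω → ℝ := fun ω => ∑ i, ∑ k, ((C ω *ᵥ x₀) i * D ω i k) * γ ω k
  have hcross_int : Integrable cross P :=
    integrable_finsetSum _ fun i _ => integrable_finsetSum _ fun k _ => (hcross i k).1
  have hcross_zero : ∫ ω, cross ω ∂P = 0 := by
    simp only [cross]
    rw [integral_finsetSum _ fun i _ => integrable_finsetSum _ fun k _ => (hcross i k).1]
    refine Finset.sum_eq_zero fun i _ => ?_
    rw [integral_finsetSum _ fun k _ => (hcross i k).1]
    exact Finset.sum_eq_zero fun k _ => (hcross i k).2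
  have hbound : ∀ᵐ ω ∂P, ∑ i, (((1 - A) ^ T *ᵥ (C ω *ᵥ x₀ + D ω *ᵥ γ ω)) i
      - (∑ j, x₀ j) / n) ^ 2 ≤
      r * ((n * ∑ i, x₀ i ^ 2 + 2 * cross ω) + 2 * q * S * ∑ i, γ ω i ^ 2) := by
    filter_upwards [hCF', hDF', hC1, hD1] with ω hc hd hc1 hd1
    have havg : ∑ j, (C ω *ᵥ x₀ + D ω *ᵥ γ ω) j = ∑ j, x₀ j := by
      simp only [Pi.add_apply, Finset.sum_add_distrib, mulVec, dotProduct]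
      rw [Finset.sum_comm, Finset.sum_comm (f := fun i j => D ω i j * γ ω j)]
      simp [← Finset.sum_mul, hc1, hd1]
    have h := sum_one_sub_pow_mulVec_sub_average_sq_le hn2 hAsymm hA1 hmono hchar
      (fun i => (he i).2) (hlamG ▸ hlamG0) T (C ω *ᵥ x₀ + D ω *ᵥ γ ω)
    rw [havg, ← hlamG, ← hr] at h
    refine h.trans (mul_le_mul_of_nonneg_left ?_ hr0)
    have hexp : ∑ i, (C ω *ᵥ x₀ + D ω *ᵥ γ ω) i ^ 2 =
        ∑ i, (C ω *ᵥ x₀) i ^ 2 + 2 * cross ω + ∑ i, (D ω *ᵥ γ ω) i ^ 2 := by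
      simp only [cross, Finset.mul_sum, ← Finset.sum_add_distrib]
      refine Finset.sum_congr rfl fun i _ => ?_
      have : ∑ k, 2 * (((C ω *ᵥ x₀) i * D ω i k) * γ ω k) =
          2 * (C ω *ᵥ x₀) i * (D ω *ᵥ γ ω) i := by
        rw [show (D ω *ᵥ γ ω) i = ∑ k, D ω i k * γ ω k from rfl, Finset.mul_sum]
        exact Finset.sum_congr rfl fun k _ => by ring
      rw [this, Pi.add_apply]
      ring
    rw [hexp]
    gcongr
    · exact ((C ω).sum_mulVec_sq_le x₀).trans (by gcongr)
    · exact ((D ω).sum_mulVec_sq_le (γ ω)).trans (by gcongr)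
  have hint1 : Integrable (fun ω => n * ∑ i, x₀ i ^ 2 + 2 * cross ω) P :=
    (integrable_const _).add (hcross_int.const_mul 2)
  have hint2 : Integrable (fun ω => 2 * q * S * ∑ i, γ ω i ^ 2) P := hγ2.const_mul _
  calc _ ≤ ∫ ω, r * ((n * ∑ i, x₀ i ^ 2 + 2 * cross ω) + 2 * q * S * ∑ i, γ ω i ^ 2) ∂P :=
        integral_mono_of_nonneg (ae_of_all _ fun ω => Finset.sum_nonneg fun i _ => sq_nonneg _)
          ((hint1.add hint2).const_mul r) hbound
    _ = r * (n * ∑ i, x₀ i ^ 2 + 2 * q * S * ∫ ω, ∑ i, γ ω i ^ 2 ∂P) := by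
        rw [integral_const_mul, integral_add hint1 hint2,
          integral_add (integrable_const _) (hcross_int.const_mul 2), integral_const_mul,
          integral_const_mul, integral_const_mul, hcross_zero]
        simp
    _ ≤ r * M := by
        refine mul_le_mul_of_nonneg_left ?_ hr0
        have h := mul_le_mul_of_nonneg_left hγvar (show (0 : ℝ) ≤ 2 * q * S by positivity)
        rw [hM]
        linarith
    _ ≤ ν := hrM
end
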